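/- Let a Markov flow graph with all node probabilities positive be given, let ρ > 0, let [l⁰_1, l¹_1], …, [l⁰_m, l¹_m] be pairwise non-overlapping intervals with 0 ≤ l⁰_j < l¹_j ≤ N for each j, and for each j let W_j ⊆ L_{l⁰_j} be a set of nodes such that |A(w) − A(x)| ≥ ρ for every w ∈ W_j and every x ∈ L_{l¹_j}. Then Σ_j Σ_{w ∈ W_j} p(w) ≤ (1/ρ²)·(φ(0) − φ(N)). (Here p(w) equals the total capacity of the edges leaving w, so this bounds the cost of removing all nodes in all the sets W_j.) -/

import Mathlib

open Finset

/-- A (layered) Markov flow graph: layers `L 0, …, L N` of nodes (pairwise disjoint, nonempty),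
an initial distribution `p0` on `L 0`, and transition probabilities `q` supported on pairs of
consecutive layers, with rows summing to `1`. -/
structure MarkovFlow (V : Type) [Fintype V] [DecidableEq V] where
  N : ℕ
  one_le_N : 1 ≤ N
  L : ℕ → Finset V
  layer_nonempty : ∀ l, l ≤ N → (L l).Nonempty
  layer_disjoint : ∀ l m, l ≤ N → m ≤ N → l ≠ m → Disjoint (L l) (L m)
  p0 : V → ℝ
  p0_nonneg : ∀ u, 0 ≤ p0 u
  p0_supp : ∀ u, u ∉ L 0 → p0 u = 0
  p0_sum : ∑ u ∈ L 0, p0 u = 1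
  q : V → V → ℝ
  q_nonneg : ∀ u v, 0 ≤ q u v
  q_le_one : ∀ u v, q u v ≤ 1
  q_supp : ∀ u v, q u v ≠ 0 → ∃ l, l < N ∧ u ∈ L l ∧ v ∈ L (l + 1)
  q_row : ∀ l, l < N → ∀ u ∈ L l, ∑ v ∈ L (l + 1), q u v = 1

namespace MarkovFlow

variable {V : Type} [Fintype V] [DecidableEq V]

/-- The marginal probability `p(u) = Pr[X_l = u]`. -/
noncomputable def pm (M : MarkovFlow V) : ℕ → V → ℝ
  | 0 => M.p0
  | l + 1 => fun v => ∑ u, pm M l u * M.q u v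

/-- The `d`-step transition probability from node `u`. -/
noncomputable def cond (M : MarkovFlow V) (u : V) : ℕ → V → ℝ
  | 0 => fun v => if v = u then 1 else 0
  | d + 1 => fun v => ∑ w, cond M u d w * M.q w v

/-- The joint probability `p(u,v) = Pr[X_{l₁} = u ∧ X_{l₂} = v]` (for `l₁ ≤ l₂`). -/
noncomputable def pj (M : MarkovFlow V) (l₁ l₂ : ℕ) (u v : V) : ℝ :=
  pm M l₁ u * cond M u (l₂ - l₁) v

/-- `A(v) = Pr[X_0 = s₀ ∣ X_l = v] - 1/2 = p(s₀,v)/p(v) - 1/2`. -/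
noncomputable def A (M : MarkovFlow V) (s₀ : V) (l : ℕ) (v : V) : ℝ :=
  pj M 0 l s₀ v / pm M l v - 1 / 2

/-- The potential `φ(l) = Var[A(X_l)]`. -/
noncomputable def phi (M : MarkovFlow V) (s₀ : V) (l : ℕ) : ℝ :=
  (∑ v ∈ M.L l, pm M l v * (A M s₀ l v) ^ 2) - (∑ v ∈ M.L l, pm M l v * A M s₀ l v) ^ 2

end MarkovFlow

namespace MarkovFlow

variable {V : Type} [Fintype V] [DecidableEq V] (M : MarkovFlow V)

lemma mem_layer_succ_of_q_ne_zero {l : ℕ} (hl : l ≤ M.N) {u v : V} (hu : u ∈ M.L l)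
    (h : M.q u v ≠ 0) : v ∈ M.L (l + 1) := by
  obtain ⟨k, hk, huk, hv⟩ := M.q_supp u v h
  have hkl : k = l := by
    by_contra hne
    exact Finset.disjoint_left.mp (M.layer_disjoint k l hk.le hl hne) huk hu
  rwa [← hkl]

lemma sum_q_eq_one {l : ℕ} (hl : l < M.N) {u : V} (hu : u ∈ M.L l) :
    ∑ v, M.q u v = 1 := by
  rw [← M.q_row l hl u hu]
  refine (Finset.sum_subset (Finset.subset_univ _) fun v _ hv => ?_).symm
  by_contra h
  exact hv (M.mem_layer_succ_of_q_ne_zero hl.le hu h)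

lemma pm_eq_zero_of_notMem {l : ℕ} (hl : l ≤ M.N) {v : V} (hv : v ∉ M.L l) :
    M.pm l v = 0 := by
  induction l generalizing v with
  | zero => exact M.p0_supp v hv
  | succ l ih =>
    refine Finset.sum_eq_zero fun u _ => ?_
    by_cases hu : u ∈ M.L l
    · have : M.q u v = 0 := by
        by_contra h
        exact hv (M.mem_layer_succ_of_q_ne_zero (by omega) hu h)
      rw [this, mul_zero]
    · rw [ih (by omega) hu, zero_mul]

lemma cond_eq_zero_of_notMem {l d : ℕ} (hl : l + d ≤ M.N) {u v : V} (hu : u ∈ M.L l)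
    (hv : v ∉ M.L (l + d)) : M.cond u d v = 0 := by
  induction d generalizing v with
  | zero =>
    have : v ≠ u := fun h => hv (h ▸ hu)
    simp [cond, this]
  | succ d ih =>
    refine Finset.sum_eq_zero fun w _ => ?_
    by_cases hw : w ∈ M.L (l + d)
    · have : M.q w v = 0 := by
        by_contra h
        exact hv (M.mem_layer_succ_of_q_ne_zero (l := l + d) (by omega) hw h)
      rw [this, mul_zero]
    · rw [ih (by omega) hw, zero_mul]

lemma pm_nonneg (l : ℕ) (v : V) : 0 ≤ M.pm l v := by
  induction l generalizing v with
  | zero => exact M.p0_nonneg v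
  | succ l ih => exact Finset.sum_nonneg fun u _ => mul_nonneg (ih u) (M.q_nonneg u v)

lemma cond_nonneg (u : V) (d : ℕ) (v : V) : 0 ≤ M.cond u d v := by
  induction d generalizing v with
  | zero => simp only [cond]; split_ifs <;> norm_num
  | succ d ih => exact Finset.sum_nonneg fun w _ => mul_nonneg (ih w) (M.q_nonneg w v)

lemma sum_cond_eq_one {l d : ℕ} (hl : l + d ≤ M.N) {u : V} (hu : u ∈ M.L l) :
    ∑ v, M.cond u d v = 1 := by
  induction d with
  | zero => simp [cond]
  | succ d ih =>
    rw [← ih (by omega)]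
    simp only [cond]
    rw [Finset.sum_comm]
    refine Finset.sum_congr rfl fun w _ => ?_
    rw [← Finset.mul_sum]
    by_cases hw : w ∈ M.L (l + d)
    · rw [M.sum_q_eq_one (by omega) hw, mul_one]
    · rw [M.cond_eq_zero_of_notMem (by omega) hu hw, zero_mul]

/-- A family of functions evolving by the transition probabilities evolves by `cond` over
several steps. -/
lemma eq_sum_mul_cond {f : ℕ → V → ℝ} (hf : ∀ l v, f (l + 1) v = ∑ u, f l u * M.q u v)
    (l d : ℕ) (v : V) : f (l + d) v = ∑ u, f l u * M.cond u d v := by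
  induction d generalizing v with
  | zero => simp [cond]
  | succ d ih =>
    rw [← add_assoc, hf]
    simp only [ih, cond, Finset.sum_mul, Finset.mul_sum]
    rw [Finset.sum_comm]
    simp only [mul_assoc]

variable {M} {s₀ : V}

lemma pm_mul_A (hs : s₀ ∈ M.L 0) (hpos : ∀ l, l ≤ M.N → ∀ u ∈ M.L l, 0 < M.pm l u)
    {l : ℕ} (hl : l ≤ M.N) (v : V) :
    M.pm l v * M.A s₀ l v = M.pj 0 l s₀ v - M.pm l v / 2 := by
  by_cases hv : v ∈ M.L l
  · have := (hpos l hl v hv).ne'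
    unfold A
    field_simp
  · have hc : M.cond s₀ l v = 0 :=
      M.cond_eq_zero_of_notMem (l := 0) (by omega) hs (by rwa [Nat.zero_add])
    simp [pj, M.pm_eq_zero_of_notMem hl hv, hc]

/-- The quantity `p(v) A(v)` is transported by the transition probabilities. -/
lemma pm_mul_A_add (hs : s₀ ∈ M.L 0) (hpos : ∀ l, l ≤ M.N → ∀ u ∈ M.L l, 0 < M.pm l u)
    {l d : ℕ} (hl : l + d ≤ M.N) (v : V) :
    M.pm (l + d) v * M.A s₀ (l + d) v = ∑ u, M.pm l u * M.A s₀ l u * M.cond u d v := by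
  rw [pm_mul_A hs hpos hl,
    M.eq_sum_mul_cond (f := fun l v => M.pj 0 l s₀ v - M.pm l v / 2) ?_ l d v]
  · exact Finset.sum_congr rfl fun u _ => by rw [pm_mul_A hs hpos (by omega)]
  · intro l v
    simp only [pj, pm, cond, Nat.sub_zero, Finset.mul_sum, Finset.sum_div,
      ← Finset.sum_sub_distrib]
    exact Finset.sum_congr rfl fun u _ => by ring

lemma sum_pm_mul (M : MarkovFlow V) {l : ℕ} (hl : l ≤ M.N) (f : V → ℝ) :
    ∑ v ∈ M.L l, M.pm l v * f v = ∑ v, M.pm l v * f v :=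
  Finset.sum_subset (Finset.subset_univ _) fun v _ hv => by
    rw [M.pm_eq_zero_of_notMem hl hv, zero_mul]

/-- The mean of `A` does not depend on the layer. -/
lemma sum_pm_mul_A_add (hs : s₀ ∈ M.L 0) (hpos : ∀ l, l ≤ M.N → ∀ u ∈ M.L l, 0 < M.pm l u)
    {l d : ℕ} (hl : l + d ≤ M.N) :
    ∑ v, M.pm (l + d) v * M.A s₀ (l + d) v = ∑ u, M.pm l u * M.A s₀ l u := by
  simp only [pm_mul_A_add hs hpos hl]
  rw [Finset.sum_comm]
  refine Finset.sum_congr rfl fun u _ => ?_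
  rw [← Finset.mul_sum]
  by_cases hu : u ∈ M.L l
  · rw [M.sum_cond_eq_one hl hu, mul_one]
  · rw [M.pm_eq_zero_of_notMem (by omega) hu]; simp

/-- The drop of the potential between two layers is the mean squared change of `A`. -/
lemma phi_sub_phi_add (hs : s₀ ∈ M.L 0) (hpos : ∀ l, l ≤ M.N → ∀ u ∈ M.L l, 0 < M.pm l u)
    {l d : ℕ} (hl : l + d ≤ M.N) :
    M.phi s₀ l - M.phi s₀ (l + d) =
      ∑ u, ∑ v, M.pm l u * M.cond u d v * (M.A s₀ l u - M.A s₀ (l + d) v) ^ 2 := by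
  have hl' : l ≤ M.N := by omega
  unfold phi
  rw [M.sum_pm_mul hl', M.sum_pm_mul hl', M.sum_pm_mul hl, M.sum_pm_mul hl,
    sum_pm_mul_A_add hs hpos hl]
  have h₁ : ∑ u, ∑ v, M.pm l u * M.cond u d v * M.A s₀ l u ^ 2 =
      ∑ u, M.pm l u * M.A s₀ l u ^ 2 := by
    refine Finset.sum_congr rfl fun u _ => ?_
    rw [← Finset.sum_mul, ← Finset.mul_sum]
    by_cases hu : u ∈ M.L l
    · rw [M.sum_cond_eq_one hl hu, mul_one]
    · rw [M.pm_eq_zero_of_notMem hl' hu]; simp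
  have h₂ : ∑ u, ∑ v, M.pm l u * M.A s₀ l u * M.cond u d v * M.A s₀ (l + d) v =
      ∑ v, M.pm (l + d) v * M.A s₀ (l + d) v ^ 2 := by
    rw [Finset.sum_comm]
    refine Finset.sum_congr rfl fun v _ => ?_
    rw [← Finset.sum_mul, ← pm_mul_A_add hs hpos hl]
    ring
  have h₃ : ∑ u, ∑ v, M.pm l u * M.cond u d v * M.A s₀ (l + d) v ^ 2 =
      ∑ v, M.pm (l + d) v * M.A s₀ (l + d) v ^ 2 := by
    rw [Finset.sum_comm]
    refine Finset.sum_congr rfl fun v _ => ?_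
    rw [← Finset.sum_mul, ← M.eq_sum_mul_cond (f := M.pm) fun _ _ => rfl]
  have h₄ : ∑ u, ∑ v, M.pm l u * M.cond u d v * (M.A s₀ l u - M.A s₀ (l + d) v) ^ 2 =
      ∑ u, ∑ v, M.pm l u * M.cond u d v * M.A s₀ l u ^ 2
      - 2 * ∑ u, ∑ v, M.pm l u * M.A s₀ l u * M.cond u d v * M.A s₀ (l + d) v
      + ∑ u, ∑ v, M.pm l u * M.cond u d v * M.A s₀ (l + d) v ^ 2 := by
    simp only [Finset.mul_sum, ← Finset.sum_sub_distrib, ← Finset.sum_add_distrib]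
    exact Finset.sum_congr rfl fun u _ => Finset.sum_congr rfl fun v _ => by ring
  rw [h₄, h₁, h₂, h₃]
  ring

lemma phi_succ_le (hs : s₀ ∈ M.L 0) (hpos : ∀ l, l ≤ M.N → ∀ u ∈ M.L l, 0 < M.pm l u)
    {l : ℕ} (hl : l < M.N) : M.phi s₀ (l + 1) ≤ M.phi s₀ l := by
  rw [← sub_nonneg, phi_sub_phi_add hs hpos hl]
  exact Finset.sum_nonneg fun u _ => Finset.sum_nonneg fun v _ =>
    mul_nonneg (mul_nonneg (M.pm_nonneg l u) (M.cond_nonneg u 1 v)) (sq_nonneg _)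

/-- Nodes of one layer whose `A`-value is far from all those of a later layer have mass
bounded by the drop of the potential. -/
lemma sq_mul_sum_pm_le (hs : s₀ ∈ M.L 0)
    (hpos : ∀ l, l ≤ M.N → ∀ u ∈ M.L l, 0 < M.pm l u) {ρ : ℝ} (hρ : 0 < ρ) {l d : ℕ}
    (hl : l + d ≤ M.N) {W : Finset V} (hW : W ⊆ M.L l)
    (hfar : ∀ w ∈ W, ∀ x ∈ M.L (l + d), ρ ≤ |M.A s₀ l w - M.A s₀ (l + d) x|) :
    ρ ^ 2 * ∑ w ∈ W, M.pm l w ≤ M.phi s₀ l - M.phi s₀ (l + d) := by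
  rw [phi_sub_phi_add hs hpos hl, Finset.mul_sum]
  have hnn : ∀ u v, 0 ≤ M.pm l u * M.cond u d v := fun u v =>
    mul_nonneg (M.pm_nonneg l u) (M.cond_nonneg u d v)
  refine le_trans (Finset.sum_le_sum fun w hw => ?_)
    (Finset.sum_le_sum_of_subset_of_nonneg (Finset.subset_univ W) fun u _ _ =>
      Finset.sum_nonneg fun v _ => mul_nonneg (hnn u v) (sq_nonneg _))
  calc ρ ^ 2 * M.pm l w = ∑ v, M.pm l w * M.cond w d v * ρ ^ 2 := by
        rw [← Finset.sum_mul, ← Finset.mul_sum, M.sum_cond_eq_one hl (hW hw)]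
        ring
    _ ≤ _ := Finset.sum_le_sum fun v _ => ?_
  by_cases hv : v ∈ M.L (l + d)
  · refine mul_le_mul_of_nonneg_left ?_ (hnn w v)
    rw [← sq_abs (_ - _)]
    exact pow_le_pow_left₀ hρ.le (hfar w hw v hv) 2
  · rw [M.cond_eq_zero_of_notMem hl (hW hw) hv]; simp

end MarkovFlow

/-- The total drop of an antitone sequence over pairwise non-overlapping intervals is at most
its overall drop. -/
lemma sum_sub_le_of_nonoverlapping {ι : Type*} [Fintype ι] {f : ℕ → ℝ} {N : ℕ}
    (hf : ∀ k < N, f (k + 1) ≤ f k) {a b : ι → ℕ} (hab : ∀ j, a j ≤ b j ∧ b j ≤ N)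
    (hdisj : ∀ j j', j ≠ j' → b j ≤ a j' ∨ b j' ≤ a j) :
    ∑ j, (f (a j) - f (b j)) ≤ f 0 - f N := by
  have hIco : ∀ j, f (a j) - f (b j) = ∑ k ∈ Finset.Ico (a j) (b j), (f k - f (k + 1)) := by
    intro j
    have := Finset.sum_Ico_sub f (hab j).1
    rw [← neg_sub, ← this, ← Finset.sum_neg_distrib]
    exact Finset.sum_congr rfl fun k _ => by ring
  rw [← Finset.sum_range_sub' f N]
  simp only [hIco]
  have hpd : Set.PairwiseDisjoint (↑(Finset.univ : Finset ι))
      fun j => Finset.Ico (a j) (b j) := by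
    intro j _ j' _ hne
    refine Finset.disjoint_left.mpr fun k hk hk' => ?_
    rw [Finset.mem_Ico] at hk hk'
    rcases hdisj j j' hne with h | h <;> omega
  rw [← Finset.sum_biUnion hpd]
  refine Finset.sum_le_sum_of_subset_of_nonneg (fun k hk => ?_) fun k hk _ =>
    sub_nonneg.mpr (hf k (Finset.mem_range.mp hk))
  obtain ⟨j, -, hj⟩ := Finset.mem_biUnion.mp hk
  exact Finset.mem_range.mpr ((Finset.mem_Ico.mp hj).2.trans_le (hab j).2)

/-- Lemma 8 of the paper, "cut-and-charge": given pairwise non-overlapping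
intervals `[l⁰_j, l¹_j]` and node sets `W_j ⊆ L (l⁰_j)` all of whose nodes are at `A`-distance
at least `ρ` from every node of `L (l¹_j)`, the total probability mass of the `W_j` is at most
`(1/ρ²)(φ(0) − φ(N))`. -/
theorem stmt10 (V : Type) [Fintype V] [DecidableEq V]
    (M : MarkovFlow V) (s₀ s₁ t₀ t₁ : V)
    (hL0 : M.L 0 = {s₀, s₁}) (hss : s₀ ≠ s₁)
    (hp0 : M.p0 s₀ = 1 / 2) (hp1 : M.p0 s₁ = 1 / 2)
    (hLN : M.L M.N = {t₀, t₁}) (htt : t₀ ≠ t₁)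
    (hpos : ∀ l, l ≤ M.N → ∀ u ∈ M.L l, 0 < MarkovFlow.pm M l u)
    (ρ : ℝ) (hρ : 0 < ρ)
    (m : ℕ) (l₀ l₁ : Fin m → ℕ) (W : Fin m → Finset V)
    (hint : ∀ j, l₀ j < l₁ j ∧ l₁ j ≤ M.N)
    (hnonoverlap : ∀ j j', j ≠ j' → l₁ j ≤ l₀ j' ∨ l₁ j' ≤ l₀ j)
    (hW : ∀ j, W j ⊆ M.L (l₀ j))
    (hfar : ∀ j, ∀ w ∈ W j, ∀ x ∈ M.L (l₁ j),
      ρ ≤ |MarkovFlow.A M s₀ (l₀ j) w - MarkovFlow.A M s₀ (l₁ j) x|) :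
    ∑ j, ∑ w ∈ W j, MarkovFlow.pm M (l₀ j) w ≤
      (1 / ρ ^ 2) * (MarkovFlow.phi M s₀ 0 - MarkovFlow.phi M s₀ M.N) := by
  have hs : s₀ ∈ M.L 0 := by simp [hL0]
  have hstep : ∀ j, ρ ^ 2 * ∑ w ∈ W j, MarkovFlow.pm M (l₀ j) w ≤
      MarkovFlow.phi M s₀ (l₀ j) - MarkovFlow.phi M s₀ (l₁ j) := by
    intro j
    obtain ⟨d, hd⟩ := Nat.exists_eq_add_of_le (hint j).1.le
    have hN := (hint j).2
    have hfar := hfar j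
    rw [hd] at hN hfar ⊢
    exact MarkovFlow.sq_mul_sum_pm_le hs hpos hρ hN (hW j) hfar
  have htotal := sum_sub_le_of_nonoverlapping (f := MarkovFlow.phi M s₀)
    (fun _ hk => MarkovFlow.phi_succ_le hs hpos hk)
    (fun j => ⟨(hint j).1.le, (hint j).2⟩) hnonoverlap
  have hρ2 : 0 < ρ ^ 2 := pow_pos hρ 2
  rw [one_div_mul_eq_div, le_div_iff₀ hρ2, mul_comm, Finset.mul_sum]
  exact (Finset.sum_le_sum fun j _ => hstep j).trans htotal
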